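/- Positivity of the third shock determinant: let γ>1, let U_b=(u_b,v_b,p_b,ρ_b) with ρ_b>0, p_b>0 and v_b>0, and U₁=(u,0,p,ρ) with ρ>0, p>0, u>c where c=√(γp/ρ); suppose σ₁₀ satisfies λ₁(U₁) < σ₁₀ < 0 (λ₁(U₁)=−c/√(u²−c²)), p > p_b, and the full Rankine–Hugoniot conditions σ₁₀·(W(U₁)−W(U_b)) = H(U₁)−H(U_b). Set A := DH(U₁) − σ₁₀·DW(U₁) and d := W(U₁) − W(U_b). Then det( A·r̃₄(U₁), A·r₃(U₁), A·r₂(U₁), d ) > 0, where r̃₄(U₁)=(−λ₄,1,ρλ₄u,ρλ₄u/c²) with λ₄=c/√(u²−c²), r₂(U₁)=(u,0,0,0), r₃(U₁)=(0,0,0,ρ). (Here d = A·∂_σG₁(σ₁₀,U_b) for the shock-polar parameterization G₁ by speed, obtained by differentiating the Rankine–Hugoniot conditions in σ.) -/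

import Mathlib

noncomputable section

/-- The flux map `W` of the 2-D steady full Euler system,
with state `U = (u, v, p, ρ)`. -/
def Wf (γ : ℝ) (U : Fin 4 → ℝ) : Fin 4 → ℝ :=
  ![U 3 * U 0,
    U 3 * U 0 ^ 2 + U 2,
    U 3 * U 0 * U 1,
    U 3 * U 0 * (γ * U 2 / ((γ - 1) * U 3) + (U 0 ^ 2 + U 1 ^ 2) / 2)]

/-- The flux map `H` of the 2-D steady full Euler system. -/
def Hf (γ : ℝ) (U : Fin 4 → ℝ) : Fin 4 → ℝ :=
  ![U 3 * U 1,
    U 3 * U 0 * U 1,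
    U 3 * U 1 ^ 2 + U 2,
    U 3 * U 1 * (γ * U 2 / ((γ - 1) * U 3) + (U 0 ^ 2 + U 1 ^ 2) / 2)]

/-- Jacobian matrix of `W` with respect to `(u, v, p, ρ)`. -/
def DW (γ : ℝ) (U : Fin 4 → ℝ) : Matrix (Fin 4) (Fin 4) ℝ :=
  Matrix.of fun i j => fderiv ℝ (fun V => Wf γ V i) U (Pi.single j 1)

/-- Jacobian matrix of `H` with respect to `(u, v, p, ρ)`. -/
def DH (γ : ℝ) (U : Fin 4 → ℝ) : Matrix (Fin 4) (Fin 4) ℝ :=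
  Matrix.of fun i j => fderiv ℝ (fun V => Hf γ V i) U (Pi.single j 1)

/-- The 4×4 matrix whose columns are the listed vectors. -/
def colMat (a b c d : Fin 4 → ℝ) : Matrix (Fin 4) (Fin 4) ℝ :=
  Matrix.of fun i j => ![a, b, c, d] j i


lemma DW_eq (γ u p ρ : ℝ) (hγ : 1 < γ) (hρ : 0 < ρ) :
    DW γ ![u, 0, p, ρ] = !![ρ, 0, 0, u; 2 * ρ * u, 0, 1, u ^ 2; 0, ρ * u, 0, 0;
      γ / (γ - 1) * p + 3 / 2 * ρ * u ^ 2, 0, γ / (γ - 1) * u, u ^ 3 / 2] := by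
  have h0 := hasFDerivAt_apply (𝕜 := ℝ) (0 : Fin 4) (![u, 0, p, ρ] : Fin 4 → ℝ)
  have h1 := hasFDerivAt_apply (𝕜 := ℝ) (1 : Fin 4) (![u, 0, p, ρ] : Fin 4 → ℝ)
  have h2 := hasFDerivAt_apply (𝕜 := ℝ) (2 : Fin 4) (![u, 0, p, ρ] : Fin 4 → ℝ)
  have h3 := hasFDerivAt_apply (𝕜 := ℝ) (3 : Fin 4) (![u, 0, p, ρ] : Fin 4 → ℝ)
  have hg : γ - 1 ≠ 0 := by linarith
  have hne : (γ - 1) * (![u, 0, p, ρ] : Fin 4 → ℝ) 3 ≠ 0 := by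
    simp; exact ⟨hg, hρ.ne'⟩
  have e0 := (h3.fun_mul h0).fderiv
  have e1 := ((h3.fun_mul (h0.pow 2)).fun_add h2).fderiv
  have e2 := ((h3.fun_mul h0).fun_mul h1).fderiv
  have e3 := ((h3.fun_mul h0).fun_mul (((h2.const_mul γ).fun_mul
    (HasDerivAt.comp_hasFDerivAt (f := fun V : Fin 4 → ℝ => (γ - 1) * V 3)
      (![u, 0, p, ρ] : Fin 4 → ℝ) (hasDerivAt_inv hne) (h3.const_mul (γ - 1)))).fun_add
    (((h0.pow 2).fun_add (h1.pow 2)).mul_const (2 : ℝ)⁻¹))).fderiv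
  simp only [Function.comp_def, ← div_eq_mul_inv] at e3
  ext i j
  fin_cases i
  · simp only [DW, Matrix.of_apply, Wf]
    simp [e0]
    fin_cases j <;> simp [Pi.single_apply]
  · simp only [DW, Matrix.of_apply, Wf]
    simp [e1]
    fin_cases j <;> simp [Pi.single_apply] <;> ring
  · simp only [DW, Matrix.of_apply, Wf]
    simp [e2]
    fin_cases j <;> simp [Pi.single_apply]
  · simp only [DW, Matrix.of_apply, Wf]
    simp [e3]
    fin_cases j <;> simp [Pi.single_apply] <;> field_simp <;> ring


lemma DH_eq (γ u p ρ : ℝ) (hγ : 1 < γ) (hρ : 0 < ρ) :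
    DH γ ![u, 0, p, ρ] = !![0, ρ, 0, 0; 0, ρ * u, 0, 0; 0, 0, 1, 0;
      0, γ / (γ - 1) * p + ρ * u ^ 2 / 2, 0, 0] := by
  have h0 := hasFDerivAt_apply (𝕜 := ℝ) (0 : Fin 4) (![u, 0, p, ρ] : Fin 4 → ℝ)
  have h1 := hasFDerivAt_apply (𝕜 := ℝ) (1 : Fin 4) (![u, 0, p, ρ] : Fin 4 → ℝ)
  have h2 := hasFDerivAt_apply (𝕜 := ℝ) (2 : Fin 4) (![u, 0, p, ρ] : Fin 4 → ℝ)
  have h3 := hasFDerivAt_apply (𝕜 := ℝ) (3 : Fin 4) (![u, 0, p, ρ] : Fin 4 → ℝ)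
  have hg : γ - 1 ≠ 0 := by linarith
  have hne : (γ - 1) * (![u, 0, p, ρ] : Fin 4 → ℝ) 3 ≠ 0 := by
    simp; exact ⟨hg, hρ.ne'⟩
  have e0 := (h3.fun_mul h1).fderiv
  have e2 := ((h3.fun_mul (h1.pow 2)).fun_add h2).fderiv
  have e1 := ((h3.fun_mul h0).fun_mul h1).fderiv
  have e3 := ((h3.fun_mul h1).fun_mul (((h2.const_mul γ).fun_mul
    (HasDerivAt.comp_hasFDerivAt (f := fun V : Fin 4 → ℝ => (γ - 1) * V 3)
      (![u, 0, p, ρ] : Fin 4 → ℝ) (hasDerivAt_inv hne) (h3.const_mul (γ - 1)))).fun_add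
    (((h0.pow 2).fun_add (h1.pow 2)).mul_const (2 : ℝ)⁻¹))).fderiv
  simp only [Function.comp_def, ← div_eq_mul_inv] at e3
  ext i j
  fin_cases i
  · simp only [DH, Matrix.of_apply, Hf]
    simp [e0]
    fin_cases j <;> simp [Pi.single_apply]
  · simp only [DH, Matrix.of_apply, Hf]
    simp [e1]
    fin_cases j <;> simp [Pi.single_apply] <;> ring
  · simp only [DH, Matrix.of_apply, Hf]
    simp [e2]
    fin_cases j <;> simp [Pi.single_apply]
  · simp only [DH, Matrix.of_apply, Hf]
    simp [e3]
    fin_cases j <;> simp [Pi.single_apply] <;> field_simp <;> ring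


lemma det_key (a u p ρ s l d1 d2 d3 d4 : ℝ) :
    (!![ (l - s) / l * ρ, -s * ρ * u, -s * u * ρ, d1;
      (l - s) / l * (ρ * u), -s * ρ * u ^ 2, -s * u * (2 * ρ * u), d2;
      (l - s) / l * (l * ρ * u), 0, 0, d3;
      (l - s) / l * (a * p + ρ * u ^ 2 / 2), -s * ρ * (u ^ 3 / 2),
        -s * u * (a * p + 3 / 2 * ρ * u ^ 2), d4] : Matrix (Fin 4) (Fin 4) ℝ).det =
    (l - s) / l * s ^ 2 * ρ ^ 2 * u ^ 3 * (l * ρ * u * (d4 - u * d2 + u ^ 2 / 2 * d1)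
      - a * p * d3 - l * (a * p) * (d2 - u * d1)) := by
  generalize (l - s) / l = k
  simp [Matrix.det_succ_row_zero, Fin.sum_univ_succ, Fin.succAbove]
  ring

set_option maxHeartbeats 2000000 in
/-- Positivity of the third shock determinant `det(A r̃₄, A r₃, A r₂, d)` where
`A = DH(U₁) - σ₁₀ DW(U₁)` and `d = W(U₁) - W(U_b)`, across a strong 1-shock with
`v_b > 0`, `p > p_b` and `λ₁(U₁) < σ₁₀ < 0`. -/
theorem det_third_positive
    (γ u_b v_b p_b ρ_b u p ρ σ₁₀ : ℝ) (hγ : 1 < γ)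
    (hρb : 0 < ρ_b) (hpb : 0 < p_b) (hvb : 0 < v_b)
    (hρ : 0 < ρ) (hp : 0 < p)
    (c : ℝ) (hc : c = Real.sqrt (γ * p / ρ)) (hsup : c < u)
    (lam4 : ℝ) (hlam4 : lam4 = c / Real.sqrt (u ^ 2 - c ^ 2))
    (hσ1 : -lam4 < σ₁₀) (hσ2 : σ₁₀ < 0) (hpp : p_b < p)
    (Ub U₁ : Fin 4 → ℝ) (hUb : Ub = ![u_b, v_b, p_b, ρ_b]) (hU₁ : U₁ = ![u, 0, p, ρ])
    (hRH : σ₁₀ • (Wf γ U₁ - Wf γ Ub) = Hf γ U₁ - Hf γ Ub)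
    (A : Matrix (Fin 4) (Fin 4) ℝ) (hA : A = DH γ U₁ - σ₁₀ • DW γ U₁)
    (d : Fin 4 → ℝ) (hd : d = Wf γ U₁ - Wf γ Ub) :
    0 < (colMat
        (A.mulVec ![-lam4, 1, ρ * lam4 * u, ρ * lam4 * u / c ^ 2])
        (A.mulVec ![0, 0, 0, ρ])
        (A.mulVec ![u, 0, 0, 0])
        d).det := by
  have hu : 0 < u := lt_of_le_of_lt (hc ▸ Real.sqrt_nonneg _) hsup
  have hcpos : 0 < c := by rw [hc]; positivity
  have hc2 : c ^ 2 = γ * p / ρ := by rw [hc]; exact Real.sq_sqrt (by positivity)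
  have hpc : γ * p = ρ * c ^ 2 := by rw [hc2]; field_simp
  have hlt : 0 < u ^ 2 - c ^ 2 := by nlinarith
  have hl : 0 < lam4 := by rw [hlam4]; positivity
  have hl2 : lam4 ^ 2 * (u ^ 2 - c ^ 2) = c ^ 2 := by
    rw [hlam4, div_pow, Real.sq_sqrt hlt.le]; field_simp
  have hg : 0 < γ - 1 := by linarith
  set a := γ / (γ - 1) with ha
  have hapos : 0 < a := by positivity
  have hap : a * p = ρ * c ^ 2 * (a - 1) := by
    rw [ha]; field_simp; linarith
  have hap' : a * p * (γ - 1) = ρ * c ^ 2 := by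
    rw [ha, ← hpc]; field_simp
  -- explicit fluxes
  have hW1 : Wf γ U₁ = ![ρ * u, ρ * u ^ 2 + p, 0, a * u * p + ρ * u ^ 3 / 2] := by
    subst hU₁
    ext i; fin_cases i <;> simp [Wf, ha]
    field_simp
  have hWb : Wf γ Ub = ![ρ_b * u_b, ρ_b * u_b ^ 2 + p_b, ρ_b * u_b * v_b,
      a * u_b * p_b + ρ_b * u_b * (u_b ^ 2 + v_b ^ 2) / 2] := by
    subst hUb
    ext i; fin_cases i <;> simp [Wf, ha]
    field_simp
  have hH1 : Hf γ U₁ = ![0, 0, p, 0] := by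
    subst hU₁
    ext i; fin_cases i <;> simp [Hf]
  have hHb : Hf γ Ub = ![ρ_b * v_b, ρ_b * u_b * v_b, ρ_b * v_b ^ 2 + p_b,
      a * v_b * p_b + ρ_b * v_b * (u_b ^ 2 + v_b ^ 2) / 2] := by
    subst hUb
    ext i; fin_cases i <;> simp [Hf, ha]
    field_simp
  rw [hW1, hWb, hH1, hHb] at hRH
  have R1 := congrFun hRH 0
  have R2 := congrFun hRH 1
  have R3 := congrFun hRH 2
  have R4 := congrFun hRH 3
  simp at R1 R2 R3 R4
  have hM : colMat
        (A.mulVec ![-lam4, 1, ρ * lam4 * u, ρ * lam4 * u / c ^ 2])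
        (A.mulVec ![0, 0, 0, ρ])
        (A.mulVec ![u, 0, 0, 0])
        d = !![ (lam4 - σ₁₀) / lam4 * ρ, -σ₁₀ * ρ * u, -σ₁₀ * u * ρ, d 0;
      (lam4 - σ₁₀) / lam4 * (ρ * u), -σ₁₀ * ρ * u ^ 2, -σ₁₀ * u * (2 * ρ * u), d 1;
      (lam4 - σ₁₀) / lam4 * (lam4 * ρ * u), 0, 0, d 2;
      (lam4 - σ₁₀) / lam4 * (a * p + ρ * u ^ 2 / 2), -σ₁₀ * ρ * (u ^ 3 / 2),
        -σ₁₀ * u * (a * p + 3 / 2 * ρ * u ^ 2), d 3] := by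
    rw [hA, hU₁, DW_eq γ u p ρ hγ hρ, DH_eq γ u p ρ hγ hρ, ← ha]
    have hq : ρ * lam4 * u / c ^ 2 * u * lam4 = ρ * lam4 ^ 2 + ρ := by
      field_simp; linear_combination hl2
    have hu2 : lam4 ^ 2 * u ^ 2 = c ^ 2 + c ^ 2 * lam4 ^ 2 := by linear_combination hl2
    generalize ρ * lam4 * u / c ^ 2 = q at hq
    have hlne := hl.ne'
    clear_value a
    ext i j
    fin_cases i <;> fin_cases j <;>
      simp [colMat]
    all_goals try ring
    all_goals field_simp
    all_goals try ring
    all_goals try linear_combination -σ₁₀ * hq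
    linear_combination -σ₁₀ * u ^ 2 * hq - 2 * σ₁₀ * (a - 1) * ρ * hu2 +
      2 * σ₁₀ * (1 + lam4 ^ 2) * hap
  rw [hM, det_key a u p ρ σ₁₀ lam4]
  have D0 : d 0 = ρ * u - ρ_b * u_b := by simp [hd, hW1, hWb]
  have D1 : d 1 = ρ * u ^ 2 + p - (ρ_b * u_b ^ 2 + p_b) := by simp [hd, hW1, hWb]
  have D2 : d 2 = - (ρ_b * u_b * v_b) := by simp [hd, hW1, hWb]
  have D3 : d 3 = a * u * p + ρ * u ^ 3 / 2 -
    (a * u_b * p_b + ρ_b * u_b * (u_b ^ 2 + v_b ^ 2) / 2) := by simp [hd, hW1, hWb]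
  have hs : lam4 - σ₁₀ > 0 := by linarith
  have hσsq : 0 < σ₁₀ ^ 2 := by nlinarith
  refine mul_pos (by positivity) ?_
  rw [D0, D1, D2, D3]
  clear hM hA hd D0 D1 D2 D3 hW1 hWb hH1 hHb hRH hc hlam4
  clear hUb hU₁ hσsq
  clear_value a
  obtain ⟨s, rfl⟩ : ∃ s, σ₁₀ = -s := ⟨-σ₁₀, by ring⟩
  have hs0 : 0 < s := by linarith
  -- mass flux
  have hm : ρ_b * (v_b + s * u_b) = s * ρ * u := by linarith
  have hpj : p - p_b = s * ρ * u * v_b := by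
    rw [← hm]; linarith
  have hub : u_b = u + s * v_b := by
    have h : s * ρ * u * (u_b - (u + s * v_b)) = 0 := by
      linear_combination (-(u_b - u)) * hm + s * hpj + R2 - u * R1
    have := (mul_eq_zero.mp h).resolve_left (by positivity)
    linarith
  have hen : ρ_b * (a * p + ρ * u ^ 2 / 2) =
      ρ * (a * p_b + ρ_b * (u_b ^ 2 + v_b ^ 2) / 2) := by
    have h : s * u * (ρ_b * (a * p + ρ * u ^ 2 / 2) -
      ρ * (a * p_b + ρ_b * (u_b ^ 2 + v_b ^ 2) / 2)) = 0 := by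
      linear_combination (a * p_b + ρ_b * (u_b ^ 2 + v_b ^ 2) / 2) * hm - ρ_b * R4
    have := (mul_eq_zero.mp h).resolve_left (by positivity)
    linarith
  have hvb2 : γ * (s * u * v_b) < c ^ 2 := by
    have : ρ * (γ * (s * u * v_b)) < ρ * c ^ 2 := by
      rw [← hpc]
      have : γ * (s * ρ * u * v_b) < γ * p := by
        apply mul_lt_mul_of_pos_left _ (by linarith); linarith
      linarith
    exact lt_of_mul_lt_mul_left this hρ.le
  have hY : 0 < lam4 * u * (c ^ 2 - (γ - 1) * s * u * v_b)
      + s * c ^ 2 * (u - (lam4 - s) * v_b) := by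
    have h1 := mul_pos (sub_pos.mpr hvb2) (show 0 < u * (lam4 + s) by positivity)
    have h2 : 0 < s * v_b * (γ * u ^ 2 * s + lam4 * (u ^ 2 - c ^ 2) + c ^ 2 * s) := by
      positivity
    linarith
  have hX : ∀ X : ℝ, s * X * (γ - 1) = ρ_b * v_b * ρ * (lam4 * u * (c ^ 2 - (γ - 1) * s * u * v_b)
      + s * c ^ 2 * (u - (lam4 - s) * v_b)) → 0 < X := by
    intro X h
    have h3 : 0 < s * X * (γ - 1) := by rw [h]; positivity
    by_contra hn
    have := mul_nonneg (mul_nonneg hs0.le (neg_nonneg.mpr (not_lt.mp hn))) hg.le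
    linarith
  apply hX
  have he4 : s * (a * u * p + ρ * u ^ 3 / 2 -
      (a * u_b * p_b + ρ_b * u_b * (u_b ^ 2 + v_b ^ 2) / 2) - u * (ρ * u ^ 2 + p -
      (ρ_b * u_b ^ 2 + p_b)) + u ^ 2 / 2 * (ρ * u - ρ_b * u_b)) =
      v_b * (a * p_b + ρ_b * v_b ^ 2 * (1 + s ^ 2) / 2) := by
    have : (u_b - u) ^ 2 = s ^ 2 * v_b ^ 2 := by rw [hub]; ring
    linear_combination -R4 + u * R2 - u ^ 2 / 2 * R1 + ρ_b * v_b / 2 * this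
  have he2 : ρ * u ^ 2 + p - (ρ_b * u_b ^ 2 + p_b) - u * (ρ * u - ρ_b * u_b) =
      ρ_b * v_b ^ 2 := by
    have h : s * (ρ * u ^ 2 + p - (ρ_b * u_b ^ 2 + p_b) - u * (ρ * u - ρ_b * u_b)
        - ρ_b * v_b ^ 2) = 0 := by
      linear_combination -R2 + u * R1 + ρ_b * v_b * hub
    have := (mul_eq_zero.mp h).resolve_left (by positivity)
    linarith
  have hen2 : ρ * (a * p_b + ρ_b * v_b ^ 2 * (1 + s ^ 2) / 2) = ρ_b * (a * p - ρ * s * u * v_b) := by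
    rw [hub] at hen; linear_combination -hen
  rw [he2]
  generalize a * u * p + ρ * u ^ 3 / 2 -
      (a * u_b * p_b + ρ_b * u_b * (u_b ^ 2 + v_b ^ 2) / 2) - u * (ρ * u ^ 2 + p -
      (ρ_b * u_b ^ 2 + p_b)) + u ^ 2 / 2 * (ρ * u - ρ_b * u_b) = e4 at he4 ⊢
  rw [hub]
  linear_combination (γ - 1) * lam4 * ρ * u * he4 + (γ - 1) * lam4 * u * v_b * hen2
    + (ρ_b * v_b * lam4 * u + s * ρ_b * v_b * (u + s * v_b) - s * lam4 * ρ_b * v_b ^ 2) * hap'
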